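/- arXiv:2107.10385 — 4 statements merged into one kernel-verified Lean document; each statement's English description precedes it below -/
import Mathlib

section
/- Let N ≥ 1 and m ∈ {1,…,N}. For each i ∈ {0,…,m-1}, let E_{m,i} = {j ∈ {0,…,N} : j ≡ i (mod m)}. Then L̄_{N,⌊N/m⌋-1}(E_{m,i}) = {0,…,N} for all i ∈ {0,…,m-1}. -/
open MvPolynomial

noncomputable section

namespace CoveringSymmetric

/-- `N = ∑ᵢ (kᵢ - 1)` for the uniform grid `[0,k₁-1] × ⋯ × [0,kₙ-1]`. -/
def Ntot (n : ℕ) (k : Fin n → ℕ) : ℕ := ∑ i, (k i - 1)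

/-- The integer points of the uniform grid `G = [0,k₁-1] × ⋯ × [0,kₙ-1]`. -/
def gridSet (n : ℕ) (k : Fin n → ℕ) : Set (Fin n → ℕ) := {x | ∀ i, x i < k i}

/-- The real point of `ℝⁿ` corresponding to an integer point. -/
def toR {n : ℕ} (x : Fin n → ℕ) : Fin n → ℝ := fun i => (x i : ℝ)

/-- The weight `wt(x) = ∑ᵢ xᵢ` of a point. -/
def wt {n : ℕ} (x : Fin n → ℕ) : ℕ := ∑ i, x i

/-- The weight-determined set `E̲ = {x ∈ G : wt(x) ∈ E}`. -/
def wdSet (n : ℕ) (k : Fin n → ℕ) (E : Finset ℕ) : Set (Fin n → ℕ) :=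
  {x ∈ gridSet n k | wt x ∈ E}

/-- The layer `j̲ = {x ∈ G : wt(x) = j}`. -/
def layer (n : ℕ) (k : Fin n → ℕ) (j : ℕ) : Set (Fin n → ℕ) :=
  {x ∈ gridSet n k | wt x = j}

/-- The grid is strictly unimodal (SU²):
`|0̲| < ⋯ < |⌊N/2⌋̲| = |⌈N/2⌉̲| > ⋯ > |N̲|`. -/
def SU2 (n : ℕ) (k : Fin n → ℕ) : Prop :=
  (∀ j, j < Ntot n k / 2 → (layer n k j).ncard < (layer n k (j + 1)).ncard) ∧
  (layer n k (Ntot n k / 2)).ncard = (layer n k ((Ntot n k + 1) / 2)).ncard ∧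
  (∀ j, (Ntot n k + 1) / 2 ≤ j → j < Ntot n k →
    (layer n k (j + 1)).ncard < (layer n k j).ncard)

/-- The zero set `Z_G(P)` of a polynomial within the grid. -/
def ZG (n : ℕ) (k : Fin n → ℕ) (P : MvPolynomial (Fin n) ℝ) : Set (Fin n → ℕ) :=
  {x ∈ gridSet n k | eval (toR x) P = 0}

/-- The degree-`d` Zariski closure of `S ⊆ G` within the grid. -/
def Zcl (n : ℕ) (k : Fin n → ℕ) (d : ℕ) (S : Set (Fin n → ℕ)) : Set (Fin n → ℕ) :=
  {a ∈ gridSet n k | ∀ P : MvPolynomial (Fin n) ℝ, P.totalDegree ≤ d →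
    (∀ x ∈ S, eval (toR x) P = 0) → eval (toR a) P = 0}

/-- The degree-`d` Z*-closure of a weight-determined set, as a set of weights:
`{j ∈ [0,N] : j̲ ⊆ Z-cl_{G,d}(E̲)}`. -/
def Zstar (n : ℕ) (k : Fin n → ℕ) (d : ℕ) (E : Finset ℕ) : Set ℕ :=
  {j | j ≤ Ntot n k ∧ layer n k j ⊆ Zcl n k d (wdSet n k E)}

/-- `PC_G(E)`: minimum total degree of a nontrivial polynomial cover of `E̲`. -/
def PC (n : ℕ) (k : Fin n → ℕ) (E : Finset ℕ) : ℕ :=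
  sInf {d | ∃ P : MvPolynomial (Fin n) ℝ, P.totalDegree = d ∧
    wdSet n k E ⊆ ZG n k P ∧ ZG n k P ≠ gridSet n k}

/-- `PPC_G(E)`: minimum total degree of a proper polynomial cover of `E̲`. -/
def PPC (n : ℕ) (k : Fin n → ℕ) (E : Finset ℕ) : ℕ :=
  sInf {d | ∃ P : MvPolynomial (Fin n) ℝ, P.totalDegree = d ∧
    wdSet n k E ⊆ ZG n k P ∧
    ∀ j ≤ Ntot n k, j ∉ E → ¬ (layer n k j ⊆ ZG n k P)}

/-- `EPC_G(E)`: minimum total degree of an exact polynomial cover of `E̲`. -/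
def EPC (n : ℕ) (k : Fin n → ℕ) (E : Finset ℕ) : ℕ :=
  sInf {d | ∃ P : MvPolynomial (Fin n) ℝ, P.totalDegree = d ∧ ZG n k P = wdSet n k E}

/-- `x` lies on the affine hyperplane `{y ∈ ℝⁿ : ∑ᵢ wᵢ yᵢ = c}` (with `w ≠ 0`). -/
def onHyp {n : ℕ} (w : Fin n → ℝ) (c : ℝ) (x : Fin n → ℕ) : Prop :=
  ∑ i, w i * (x i : ℝ) = c

/-- `HC_G(E)`: minimum size of a nontrivial hyperplane cover of `E̲`. -/
def HC (n : ℕ) (k : Fin n → ℕ) (E : Finset ℕ) : ℕ :=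
  sInf {m | ∃ (w : Fin m → Fin n → ℝ) (c : Fin m → ℝ), (∀ t, w t ≠ 0) ∧
    (∀ x ∈ wdSet n k E, ∃ t, onHyp (w t) (c t) x) ∧
    ∃ x ∈ gridSet n k, ∀ t, ¬ onHyp (w t) (c t) x}

/-- `PHC_G(E)`: minimum size of a proper hyperplane cover of `E̲`. -/
def PHC (n : ℕ) (k : Fin n → ℕ) (E : Finset ℕ) : ℕ :=
  sInf {m | ∃ (w : Fin m → Fin n → ℝ) (c : Fin m → ℝ), (∀ t, w t ≠ 0) ∧
    (∀ x ∈ wdSet n k E, ∃ t, onHyp (w t) (c t) x) ∧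
    ∀ j ≤ Ntot n k, j ∉ E → ¬ (layer n k j ⊆ {x | ∃ t, onHyp (w t) (c t) x})}

/-- The certifying degree of `S ⊆ G`: least `d ∈ [0,N]` such that some polynomial of
total degree at most `d` is nonconstant on `G` but constant on `S`. -/
def certDeg (n : ℕ) (k : Fin n → ℕ) (S : Set (Fin n → ℕ)) : ℕ :=
  sInf {d | d ≤ Ntot n k ∧ ∃ f : MvPolynomial (Fin n) ℝ, f.totalDegree ≤ d ∧
    (∃ a ∈ gridSet n k, ∃ b ∈ gridSet n k, eval (toR a) f ≠ eval (toR b) f) ∧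
    ∀ a ∈ S, ∀ b ∈ S, eval (toR a) f = eval (toR b) f}

/-- `T_{N,i} = [0,i-1] ∪ [N-i+1,N]` (so `T_{N,0} = ∅`). -/
def T (N i : ℕ) : Finset ℕ := Finset.range i ∪ Finset.Icc (N - i + 1) N

/-- `E` is `(d,i)`-admitting: `E ∪ T_{N,i} ≠ [0,N]` and `|E \ T_{N,i}| ≤ d - i`. -/
def Admitting (N d i : ℕ) (E : Finset ℕ) : Prop :=
  E ∪ T N i ≠ Finset.range (N + 1) ∧ (E \ T N i).card ≤ d - i

/-- `E` is `d`-admitting: `(d,i)`-admitting for some `i ∈ [0,d]`. -/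
def DAdmitting (N d : ℕ) (E : Finset ℕ) : Prop :=
  ∃ i ≤ d, Admitting N d i E

/-- The operator `L_{N,d}`: if `E = {t₁ < ⋯ < t_s}` with `s ≥ d+1`, then
`L_{N,d}(E) = [0, t_{s-d}] ∪ E ∪ [t_{d+1}, N]`, and `L_{N,d}(E) = E` if `s ≤ d`.
(For `E ⊆ [0,N]`, `j ≤ t_{s-d}` iff `E` has at least `d+1` elements `≥ j`, and
`t_{d+1} ≤ j` iff `E` has at least `d+1` elements `≤ j`.) -/
def Lop (N d : ℕ) (E : Finset ℕ) : Finset ℕ :=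
  E ∪ (Finset.range (N + 1)).filter fun j =>
    d + 1 ≤ (E.filter fun t => j ≤ t).card ∨ d + 1 ≤ (E.filter fun t => t ≤ j).card

/-- `L̄_{N,d}(E) = ⋃ₘ L_{N,d}^m(E)`, the union of all iterates of `L_{N,d}` on `E`. -/
def Lbar (N d : ℕ) (E : Finset ℕ) : Set ℕ :=
  ⋃ m : ℕ, ((Lop N d)^[m] E : Set ℕ)

/-- `P` is a (possibly empty) product of polynomials of total degree at most 1. -/
def ProdLinear (n : ℕ) (P : MvPolynomial (Fin n) ℝ) : Prop :=
  ∃ (m : ℕ) (ℓ : Fin m → MvPolynomial (Fin n) ℝ),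
    (∀ t, (ℓ t).totalDegree ≤ 1) ∧ P = ∏ t, ℓ t

/-- The degree-`d` h-closure of `S ⊆ G`. -/
def hcl (n : ℕ) (k : Fin n → ℕ) (d : ℕ) (S : Set (Fin n → ℕ)) : Set (Fin n → ℕ) :=
  {a ∈ gridSet n k | ∀ P : MvPolynomial (Fin n) ℝ, ProdLinear n P → P.totalDegree ≤ d →
    (∀ x ∈ S, eval (toR x) P = 0) → eval (toR a) P = 0}

theorem subset_Lop (N d : ℕ) (E : Finset ℕ) : E ⊆ Lop N d E :=
  Finset.subset_union_left

theorem Lop_subset_range {N : ℕ} (d : ℕ) {E : Finset ℕ} (hE : E ⊆ Finset.range (N + 1)) :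
    Lop N d E ⊆ Finset.range (N + 1) :=
  Finset.union_subset hE (Finset.filter_subset _ _)

theorem Lop_iterate_subset_range {N : ℕ} (d : ℕ) {E : Finset ℕ}
    (hE : E ⊆ Finset.range (N + 1)) (k : ℕ) : (Lop N d)^[k] E ⊆ Finset.range (N + 1) := by
  induction k with
  | zero => exact hE
  | succ k ih =>
    rw [Function.iterate_succ_apply']
    exact Lop_subset_range d ih

/-- If `L_{N,d}` strictly enlarges every proper subset of `[0,N]` containing `E`, then its
iterates on such a set reach `[0,N]`. -/
theorem exists_Lop_iterate_eq_range {N d : ℕ} {E : Finset ℕ}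
    (h : ∀ F, E ⊆ F → F ⊆ Finset.range (N + 1) → Lop N d F = F → F = Finset.range (N + 1))
    (F : Finset ℕ) (hEF : E ⊆ F) (hF : F ⊆ Finset.range (N + 1)) :
    ∃ k, (Lop N d)^[k] F = Finset.range (N + 1) := by
  by_cases hfix : Lop N d F = F
  · exact ⟨0, h F hEF hF hfix⟩
  · have hlt : F.card < (Lop N d F).card :=
      Finset.card_lt_card ((subset_Lop N d F).ssubset_of_ne (Ne.symm hfix))
    have hle : (Lop N d F).card ≤ N + 1 := by
      simpa using Finset.card_le_card (Lop_subset_range d hF)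
    obtain ⟨k, hk⟩ := exists_Lop_iterate_eq_range h (Lop N d F)
      (hEF.trans (subset_Lop N d F)) (Lop_subset_range d hF)
    exact ⟨k + 1, hk⟩
termination_by N + 1 - F.card

/-- Any `u * m` consecutive naturals contain `u` members of each residue class modulo `m`. -/
theorem exists_card_eq_residue {m i : ℕ} (hi : i < m) (x u : ℕ) :
    ∃ A : Finset ℕ, A.card = u ∧ ∀ a ∈ A, x ≤ a ∧ a < x + u * m ∧ a % m = i := by
  have hm : 0 < m := by omega
  obtain ⟨c, hc, hci⟩ : ∃ c < m, (x + c) % m = i := by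
    refine ⟨(i + (m - x % m)) % m, Nat.mod_lt _ hm, ?_⟩
    have hx := Nat.mod_lt x hm
    rw [Nat.add_mod, Nat.mod_mod, ← Nat.add_mod_mod, Nat.mod_mod, Nat.add_mod_mod,
      show x % m + (i + (m - x % m)) = i + m by omega, Nat.add_mod_right, Nat.mod_eq_of_lt hi]
  refine ⟨(Finset.range u).image fun k => x + c + m * k, ?_, ?_⟩
  · rw [Finset.card_image_of_injective _ fun a b hab => by simpa [hm.ne'] using hab,
      Finset.card_range]
  · simp only [Finset.mem_image, Finset.mem_range]
    rintro _ ⟨k, hk, rfl⟩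
    refine ⟨by omega, by nlinarith, by rw [Nat.add_mul_mod_self_left, hci]⟩

/-- The only fixed point of `L_{N,⌊N/m⌋-1}` containing a full residue class modulo `m ≥ 2`
is `[0,N]`. -/
theorem eq_range_of_Lop_eq_self {N m i : ℕ} (hm : 2 ≤ m) (hmN : m ≤ N) (hi : i < m)
    {F : Finset ℕ} (hEF : ((Finset.range (N + 1)).filter fun j => j % m = i) ⊆ F)
    (hF : F ⊆ Finset.range (N + 1)) (hfix : Lop N (N / m - 1) F = F) :
    F = Finset.range (N + 1) := by
  have hq : 1 ≤ N / m := Nat.div_pos hmN (by omega)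
  by_contra hne
  have hC : (Finset.range (N + 1) \ F).Nonempty := by
    rw [Finset.sdiff_nonempty]
    exact fun h => hne (hF.antisymm h)
  have hcount : ∀ j ∈ Finset.range (N + 1) \ F, (F.filter fun t => j ≤ t).card < N / m ∧
      (F.filter fun t => t ≤ j).card < N / m := by
    intro j hj
    rw [Finset.mem_sdiff] at hj
    have hj' : j ∉ Lop N (N / m - 1) F := hfix.symm ▸ hj.2
    simp only [Lop, Finset.mem_union, Finset.mem_filter, hj.1, hj.2, true_and, false_or,
      not_or] at hj'
    omega
  obtain ⟨x, hx, hxmin⟩ := Finset.exists_min_image _ id hC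
  obtain ⟨y, hy, hymax⟩ := Finset.exists_max_image _ id hC
  simp only [id] at hxmin hymax
  have hxy : x ≤ y := hxmin y hy
  have hyN : y < N + 1 := Finset.mem_range.1 (Finset.mem_sdiff.1 hy).1
  have hlow : ∀ j < x, j ∈ F := by
    intro j hj
    by_contra hjF
    have := hxmin j (Finset.mem_sdiff.2 ⟨Finset.mem_range.2 (by omega), hjF⟩)
    omega
  have hhigh : ∀ j, y < j → j ≤ N → j ∈ F := by
    intro j hj hjN
    by_contra hjF
    have := hymax j (Finset.mem_sdiff.2 ⟨Finset.mem_range.2 (by omega), hjF⟩)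
    omega
  set u := (y - x + 1) / m with hu
  have hum : u * m ≤ y - x + 1 := Nat.div_mul_le_self _ _
  have hum' : y - x + 1 < (u + 1) * m := Nat.lt_mul_of_div_lt (Nat.lt_succ_self _) (by omega)
  have hqN : N / m * m ≤ N := Nat.div_mul_le_self _ _
  obtain ⟨A, hAu, hA⟩ := exists_card_eq_residue hi x u
  have hAF : ∀ a ∈ A, x ≤ a ∧ a ≤ y ∧ a ∈ F := by
    intro a ha
    obtain ⟨h1, h2, h3⟩ := hA a ha
    exact ⟨h1, by omega, hEF (Finset.mem_filter.2 ⟨Finset.mem_range.2 (by omega), h3⟩)⟩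
  have hup : u + (N - y) < N / m := by
    have hd : Disjoint A (Finset.Ioc y N) := Finset.disjoint_left.2 fun a ha ha' => by
      have := hAF a ha
      rw [Finset.mem_Ioc] at ha'
      omega
    rw [← hAu, ← Nat.card_Ioc, ← Finset.card_union_of_disjoint hd]
    refine (Finset.card_le_card fun a ha => ?_).trans_lt (hcount x hx).1
    rw [Finset.mem_union, Finset.mem_Ioc] at ha
    rw [Finset.mem_filter]
    rcases ha with ha | ha
    · exact ⟨(hAF a ha).2.2, (hAF a ha).1⟩
    · exact ⟨hhigh a ha.1 ha.2, by omega⟩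
  have hdown : u + x < N / m := by
    have hd : Disjoint A (Finset.range x) := Finset.disjoint_left.2 fun a ha ha' => by
      have := hAF a ha
      rw [Finset.mem_range] at ha'
      omega
    rw [← hAu, ← Finset.card_range x, ← Finset.card_union_of_disjoint hd]
    refine (Finset.card_le_card fun a ha => ?_).trans_lt (hcount y hy).2
    rw [Finset.mem_union, Finset.mem_range] at ha
    rw [Finset.mem_filter]
    rcases ha with ha | ha
    · exact ⟨(hAF a ha).2.2, (hAF a ha).2.1⟩
    · exact ⟨hlow a ha, by omega⟩
  obtain ⟨w, hw⟩ : ∃ w, N / m = u + 1 + w := ⟨N / m - (u + 1), by omega⟩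
  have hwm : w * 2 ≤ w * m := Nat.mul_le_mul_left w hm
  rw [hw, add_mul] at hqN
  omega

/-- for residue classes `E_{m,i} = {j ∈ [0,N] : j ≡ i (mod m)}`,
`L̄_{N,⌊N/m⌋-1}(E_{m,i}) = [0,N]`. -/
theorem stmt16 (N m : ℕ) (hN : 1 ≤ N) (hm : 1 ≤ m) (hmN : m ≤ N) (i : ℕ) (hi : i < m) :
    Lbar N (N / m - 1) ((Finset.range (N + 1)).filter fun j => j % m = i)
      = ↑(Finset.range (N + 1)) := by
  have hE : ((Finset.range (N + 1)).filter fun j => j % m = i) ⊆ Finset.range (N + 1) :=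
    Finset.filter_subset _ _
  have hfix : ∀ F, ((Finset.range (N + 1)).filter fun j => j % m = i) ⊆ F →
      F ⊆ Finset.range (N + 1) → Lop N (N / m - 1) F = F → F = Finset.range (N + 1) := by
    intro F hEF hF hLF
    obtain rfl | hm2 := hm.eq_or_lt
    · refine hF.antisymm fun j hj => hEF (Finset.mem_filter.2 ⟨hj, ?_⟩)
      omega
    · exact eq_range_of_Lop_eq_self hm2 hmN hi hEF hF hLF
  obtain ⟨k, hk⟩ := exists_Lop_iterate_eq_range hfix _ subset_rfl hE
  refine Set.Subset.antisymm (Set.iUnion_subset fun l => ?_) fun j hj => ?_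
  · exact Finset.coe_subset.2 (Lop_iterate_subset_range _ hE l)
  · refine Set.mem_iUnion.2 ⟨k, ?_⟩
    rwa [hk]

end CoveringSymmetric
end
end

section
/- Let n be a positive even integer and let f ∈ ℝ[X₁,…,Xₙ] be a polynomial whose induced function on {-1,1}ⁿ is not identically zero. Suppose that either f(x) = 0 for all x ∈ {-1,1}ⁿ having an even number of coordinates equal to -1, or f(x) = 0 for all x ∈ {-1,1}ⁿ having an odd number of coordinates equal to -1. Then the total degree of f satisfies deg f ≥ n/2. -/
open MvPolynomial

noncomputable section

namespace CoveringSymmetric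

/-- A polynomial of total degree less than `n` is orthogonal on `{-1,1}ⁿ` to the
full parity character `x ↦ ∏ᵢ xᵢ`. -/
theorem sum_prod_mul_eval_eq_zero {n : ℕ} (g : MvPolynomial (Fin n) ℝ)
    (hg : g.totalDegree < n) :
    ∑ ε : Fin n → Bool, (∏ i, if ε i then (-1 : ℝ) else 1) *
      eval (fun i => if ε i then (-1 : ℝ) else 1) g = 0 := by
  simp_rw [eval_eq', Finset.mul_sum]
  rw [Finset.sum_comm]
  refine Finset.sum_eq_zero fun m hm => ?_
  obtain ⟨j, hj⟩ : ∃ j, m j = 0 := by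
    by_contra! h
    have hle : ∑ _i : Fin n, 1 ≤ ∑ i, m i :=
      Finset.sum_le_sum fun i _ => Nat.one_le_iff_ne_zero.mpr (h i)
    have hdeg := le_totalDegree hm
    rw [Finsupp.sum_fintype _ _ fun _ => rfl] at hdeg
    simp only [Finset.sum_const, Finset.card_univ, Fintype.card_fin, smul_eq_mul,
      mul_one] at hle
    omega
  calc
    _ = coeff m g * ∑ ε : Fin n → Bool, ∏ i,
        ((if ε i then (-1 : ℝ) else 1) * (if ε i then (-1 : ℝ) else 1) ^ m i) := by
      rw [Finset.mul_sum]
      refine Finset.sum_congr rfl fun ε _ => ?_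
      rw [Finset.prod_mul_distrib]
      ring
    _ = coeff m g * ∏ i, ∑ b : Bool,
        ((if b then (-1 : ℝ) else 1) * (if b then (-1 : ℝ) else 1) ^ m i) := by
      rw [Fintype.prod_sum]
    _ = 0 := by
      rw [Finset.prod_eq_zero (Finset.mem_univ j) (by simp [hj]), mul_zero]

/-- The parity character at a sign vector is determined by its number of `-1` coordinates. -/
theorem prod_sign_eq_neg_one_pow {n : ℕ} (ε : Fin n → Bool) :
    (∏ i, if ε i then (-1 : ℝ) else 1) =
      (-1) ^ (Finset.univ.filter fun i => ε i = true).card := by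
  rw [Finset.prod_ite, Finset.prod_const, Finset.prod_const_one, mul_one]

/-- If `f` has total degree less than `n / 2` and is supported, as a function on `{-1,1}ⁿ`,
where the parity character takes the value `s`, with `s ≠ 0`, then `f` vanishes on `{-1,1}ⁿ`. -/
theorem eval_eq_zero_of_prod_eq {n : ℕ} (f : MvPolynomial (Fin n) ℝ)
    (hf : 2 * f.totalDegree < n) {s : ℝ} (hs : s ≠ 0)
    (h : ∀ ε : Fin n → Bool, eval (fun i => if ε i then (-1 : ℝ) else 1) f = 0 ∨
      (∏ i, if ε i then (-1 : ℝ) else 1) = s) (ε : Fin n → Bool) :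
    eval (fun i => if ε i then (-1 : ℝ) else 1) f = 0 := by
  have hsum := sum_prod_mul_eval_eq_zero (f ^ 2) ((totalDegree_pow f 2).trans_lt hf)
  have hsq : s * ∑ ε : Fin n → Bool,
      eval (fun i => if ε i then (-1 : ℝ) else 1) f ^ 2 = 0 := by
    rw [← hsum, Finset.mul_sum]
    refine Finset.sum_congr rfl fun ε _ => ?_
    rw [map_pow]
    rcases h ε with h | h <;> simp [h]
  rw [mul_eq_zero, or_iff_right hs, Finset.sum_eq_zero_iff_of_nonneg fun _ _ => sq_nonneg _] at hsq
  exact pow_eq_zero_iff two_ne_zero |>.mp (hsq ε (Finset.mem_univ ε))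

/-- Alon–Bergmann–Coppersmith–Odlyzko: if `n` is even and `f` represents a
nonzero function on `{-1,1}ⁿ` vanishing on all points with an even (resp. odd) number of
`-1` coordinates, then `deg f ≥ n/2`. -/
theorem stmt17 (n : ℕ) (hn : 0 < n) (hev : Even n) (f : MvPolynomial (Fin n) ℝ)
    (hnz : ∃ ε : Fin n → Bool, eval (fun i => if ε i then (-1 : ℝ) else 1) f ≠ 0)
    (hcond :
      (∀ ε : Fin n → Bool, Even (Finset.univ.filter fun i => ε i = true).card →
        eval (fun i => if ε i then (-1 : ℝ) else 1) f = 0) ∨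
      (∀ ε : Fin n → Bool, Odd (Finset.univ.filter fun i => ε i = true).card →
        eval (fun i => if ε i then (-1 : ℝ) else 1) f = 0)) :
    n / 2 ≤ f.totalDegree := by
  by_contra! hlt
  obtain ⟨ε, hε⟩ := hnz
  rcases hcond with h | h
  · refine hε (eval_eq_zero_of_prod_eq f (by omega) (s := -1) (by norm_num) (fun δ => ?_) ε)
    rw [prod_sign_eq_neg_one_pow]
    rcases Nat.even_or_odd (Finset.univ.filter fun i => δ i = true).card with hδ | hδ
    · exact Or.inl (h δ hδ)
    · exact Or.inr hδ.neg_one_pow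
  · refine hε (eval_eq_zero_of_prod_eq f (by omega) one_ne_zero (fun δ => ?_) ε)
    rw [prod_sign_eq_neg_one_pow]
    rcases Nat.even_or_odd (Finset.univ.filter fun i => δ i = true).card with hδ | hδ
    · exact Or.inr hδ.neg_one_pow
    · exact Or.inl (h δ hδ)

end CoveringSymmetric
end
end

section
/- Let G be a uniform grid and E ⊊ {0,…,N}. Then EPC_G(E) = min{d ∈ {0,…,N} : Z-cl_{G,d}(E̲) = E̲}. -/
open MvPolynomial

noncomputable section

namespace CoveringSymmetric

theorem exists_mem_forall_ne_zero {K M ι : Type*} [Field K] [Infinite K] [AddCommGroup M]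
    [Module K M] (V : Submodule K M) (φ : ι → M →ₗ[K] K) (A : Finset ι)
    (h : ∀ a ∈ A, ∃ v ∈ V, φ a v ≠ 0) : ∃ v ∈ V, ∀ a ∈ A, φ a v ≠ 0 := by
  classical
  induction A using Finset.induction_on with
  | empty => exact ⟨0, V.zero_mem, by simp⟩
  | insert a A _ ih =>
    obtain ⟨v, hv, hvA⟩ := ih fun b hb => h b (Finset.mem_insert_of_mem hb)
    obtain ⟨w, hw, hwa⟩ := h a (Finset.mem_insert_self a A)
    obtain ⟨c, hc⟩ := Infinite.exists_notMem_finset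
      ((insert a A).image fun b => -φ b v / φ b w)
    refine ⟨v + c • w, V.add_mem hv (V.smul_mem c hw), fun b hb h0 => ?_⟩
    simp only [map_add, map_smul, smul_eq_mul] at h0
    by_cases hb0 : φ b w = 0
    · rcases Finset.mem_insert.1 hb with rfl | hbA
      · exact hwa hb0
      · exact hvA b hbA (by simpa [hb0] using h0)
    · refine hc (Finset.mem_image.2 ⟨b, hb, ?_⟩)
      rw [div_eq_iff hb0]
      linear_combination -h0

theorem finite_gridSet (n : ℕ) (k : Fin n → ℕ) : (gridSet n k).Finite :=
  (Set.finite_Iic k).subset fun _ hx i => (hx i).le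

theorem exists_exact_cover_le_card (n : ℕ) (k : Fin n → ℕ) (E : Finset ℕ) :
    ∃ P : MvPolynomial (Fin n) ℝ, P.totalDegree ≤ E.card ∧ ZG n k P = wdSet n k E := by
  refine ⟨∏ e ∈ E, (∑ i, X i - C (e : ℝ)), ?_, ?_⟩
  · refine (totalDegree_finsetProd _ _).trans ?_
    refine (Finset.sum_le_card_nsmul E _ 1 fun e _ => ?_).trans (by simp)
    refine (totalDegree_sub_C_le _ _).trans (totalDegree_finsetSum_le fun i _ => ?_)
    exact (totalDegree_X i).le
  · ext x
    have key : ∀ e : ℕ, ∑ i, (x i : ℝ) - e = 0 ↔ wt x = e := fun e => by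
      rw [sub_eq_zero, wt]
      exact_mod_cast Iff.rfl
    simp [ZG, wdSet, toR, Finset.prod_eq_zero_iff, key]

theorem Zcl_eq_of_ZG_eq {n : ℕ} {k : Fin n → ℕ} {d : ℕ} {S : Set (Fin n → ℕ)}
    {P : MvPolynomial (Fin n) ℝ} (hd : P.totalDegree ≤ d) (hP : ZG n k P = S) :
    Zcl n k d S = S := by
  subst hP
  exact Set.Subset.antisymm (fun a ha => ⟨ha.1, ha.2 P hd fun x hx => hx.2⟩)
    fun a ha => ⟨ha.1, fun Q _ hQ => hQ a ha⟩

theorem exists_ZG_eq_of_Zcl_eq {n : ℕ} {k : Fin n → ℕ} {d : ℕ} {S : Set (Fin n → ℕ)}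
    (hS : Zcl n k d S = S) :
    ∃ P : MvPolynomial (Fin n) ℝ, P.totalDegree ≤ d ∧ ZG n k P = S := by
  let V : Submodule ℝ (MvPolynomial (Fin n) ℝ) :=
    restrictTotalDegree (Fin n) ℝ d ⊓ ⨅ x ∈ S, LinearMap.ker (aeval (toR x)).toLinearMap
  have hV : ∀ P, P ∈ V ↔ P.totalDegree ≤ d ∧ ∀ x ∈ S, eval (toR x) P = 0 := fun P => by
    simp [V, mem_restrictTotalDegree, Submodule.mem_iInf, aeval_eq_eval]
  obtain ⟨P, hPV, hP⟩ := exists_mem_forall_ne_zero V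
    (fun x : Fin n → ℕ => (aeval (toR x) : MvPolynomial (Fin n) ℝ →ₐ[ℝ] ℝ).toLinearMap)
    ((finite_gridSet n k).subset (Set.sdiff_subset (t := S))).toFinset (fun a ha => by
      rw [Set.Finite.mem_toFinset] at ha
      by_contra! hcon
      refine ha.2 (hS ▸ ⟨ha.1, fun Q hQd hQ => ?_⟩)
      simpa [aeval_eq_eval] using hcon Q ((hV Q).2 ⟨hQd, hQ⟩))
  obtain ⟨hPd, hPS⟩ := (hV P).1 hPV
  refine ⟨P, hPd, Set.Subset.antisymm (fun a ha => ?_) fun a ha => ⟨?_, hPS a ha⟩⟩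
  · by_contra haS
    exact hP a ((Set.Finite.mem_toFinset _).2 ⟨ha.1, haS⟩) (by simpa [aeval_eq_eval] using ha.2)
  · rw [← hS] at ha
    exact ha.1

theorem EPC_le_totalDegree {n : ℕ} {k : Fin n → ℕ} {E : Finset ℕ}
    {P : MvPolynomial (Fin n) ℝ} (hP : ZG n k P = wdSet n k E) : EPC n k E ≤ P.totalDegree :=
  Nat.sInf_le (m := P.totalDegree) ⟨P, rfl, hP⟩

/-- `EPC_G(E) = min{d ∈ [0,N] : Z-cl_{G,d}(E̲) = E̲}`. -/
theorem stmt18 (n : ℕ) (hn : 1 ≤ n) (k : Fin n → ℕ) (hk : ∀ i, 2 ≤ k i)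
    (E : Finset ℕ) (hE : E ⊂ Finset.range (Ntot n k + 1)) :
    EPC n k E = sInf {d | d ≤ Ntot n k ∧ Zcl n k d (wdSet n k E) = wdSet n k E} := by
  obtain ⟨Q, hQd, hQ⟩ := exists_exact_cover_le_card n k E
  have hcard : E.card ≤ Ntot n k := by
    simpa [Nat.lt_succ_iff] using Finset.card_lt_card hE
  obtain ⟨P, hPd, hP⟩ := Nat.sInf_mem (s := {d | ∃ P : MvPolynomial (Fin n) ℝ,
    P.totalDegree = d ∧ ZG n k P = wdSet n k E}) ⟨_, Q, rfl, hQ⟩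
  have hEPC : EPC n k E ≤ Ntot n k := (EPC_le_totalDegree hQ).trans (hQd.trans hcard)
  have hmem : EPC n k E ∈ {d | d ≤ Ntot n k ∧ Zcl n k d (wdSet n k E) = wdSet n k E} :=
    ⟨hEPC, Zcl_eq_of_ZG_eq hPd.le hP⟩
  refine le_antisymm (le_csInf ⟨_, hmem⟩ fun d hd => ?_) (Nat.sInf_le hmem)
  obtain ⟨R, hRd, hR⟩ := exists_ZG_eq_of_Zcl_eq hd.2
  exact (EPC_le_totalDegree hR).trans hRd

end CoveringSymmetric
end
end

section
/- Consider the Boolean cube {0,1}ⁿ. For any E ⊊ {0,…,n}, EPC_n(E) = PPC_n(E) = PHC_n(E) = |E| - max{i ∈ {0,…,n} : T_{n,i} ⊆ E}. -/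
open MvPolynomial

noncomputable section

namespace CoveringSymmetric

lemma wt_le_of_mem {n : ℕ} {x : Fin n → ℕ} (hx : ∀ k, x k < 2) : wt x ≤ n := by
  calc wt x ≤ ∑ _k : Fin n, 1 := Finset.sum_le_sum fun k _ => by have := hx k; omega
    _ = n := by simp

lemma Ntot_two (n : ℕ) : Ntot n (fun _ => 2) = n := by simp [Ntot]

/-- On the Boolean cube, the weight counts the ones. -/
lemma card_ones {n : ℕ} {x : Fin n → ℕ} (hx : ∀ k, x k < 2) :
    (Finset.univ.filter fun k => x k = 1).card = wt x := by
  rw [Finset.card_filter, wt]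
  refine Finset.sum_congr rfl fun k _ => ?_
  have := hx k
  split_ifs <;> omega

lemma card_zeros {n : ℕ} {x : Fin n → ℕ} (hx : ∀ k, x k < 2) :
    (Finset.univ.filter fun k => x k = 0).card = n - wt x := by
  have h : (Finset.univ.filter fun k => x k = 0) = (Finset.univ.filter fun k => x k = 1)ᶜ := by
    ext k
    have := hx k
    simp only [Finset.mem_filter, Finset.mem_univ, true_and, Finset.mem_compl]
    omega
  rw [h, Finset.card_compl, card_ones hx, Fintype.card_fin]

/-- The point whose first `j` coordinates are one and whose other coordinates are zero. -/
def initialPoint (n j : ℕ) : Fin n → ℕ := fun k => if (k : ℕ) < j then 1 else 0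

lemma initialPoint_lt (n j : ℕ) (k : Fin n) : initialPoint n j k < 2 := by
  unfold initialPoint
  split_ifs <;> omega

lemma wt_initialPoint {n j : ℕ} (hj : j ≤ n) : wt (initialPoint n j) = j := by
  simp only [wt, initialPoint]
  rw [Fin.sum_univ_eq_sum_range (fun k => if k < j then 1 else 0) n, ← Finset.card_filter]
  have : (Finset.range n).filter (· < j) = Finset.range j := by
    ext k
    simp only [Finset.mem_filter, Finset.mem_range]
    omega
  rw [this, Finset.card_range]

/-- The linear form `∑ₖ Xₖ - j`, vanishing exactly on the points of weight `j`. -/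
def wtForm (n j : ℕ) : MvPolynomial (Fin n) ℝ := ∑ k, X k - C (j : ℝ)

lemma eval_wtForm {n : ℕ} (j : ℕ) (x : Fin n → ℕ) :
    eval (toR x) (wtForm n j) = (wt x : ℝ) - j := by
  simp [wtForm, toR, wt]

lemma totalDegree_sub_C_le {n : ℕ} {P : MvPolynomial (Fin n) ℝ} {d : ℕ} (hP : P.totalDegree ≤ d)
    (c : ℝ) : (P - C c).totalDegree ≤ d :=
  (totalDegree_sub _ _).trans (max_le hP (by simp))

lemma totalDegree_wtForm_le (n j : ℕ) : (wtForm n j).totalDegree ≤ 1 :=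
  totalDegree_sub_C_le (totalDegree_finsetSum_le fun k _ => (totalDegree_X k).le) _

/-- A product of polynomials of degree at most one has degree at most the number of factors. -/
lemma totalDegree_prod_le_card {ι : Type*} {n : ℕ} (s : Finset ι)
    (f : ι → MvPolynomial (Fin n) ℝ) (hf : ∀ t ∈ s, (f t).totalDegree ≤ 1) :
    (∏ t ∈ s, f t).totalDegree ≤ s.card := by
  refine (totalDegree_finsetProd s f).trans ((Finset.sum_le_sum hf).trans ?_)
  simp

lemma eval_prod_wtForm_ne_zero_iff {n : ℕ} (W : Finset ℕ) (x : Fin n → ℕ) :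
    eval (toR x) (∏ w ∈ W, wtForm n w) ≠ 0 ↔ wt x ∉ W := by
  rw [map_prod, Finset.prod_ne_zero_iff]
  simp only [eval_wtForm, ne_eq, sub_eq_zero, Nat.cast_inj]
  exact ⟨fun h hx => h _ hx rfl, fun h w hw e => h (e ▸ hw)⟩

/-- The alternating sum over the Boolean cube of a polynomial of degree less than `n` is zero. -/
lemma alternating_sum_eq_zero {n : ℕ} (P : MvPolynomial (Fin n) ℝ) (hP : P.totalDegree < n) :
    ∑ x ∈ Fintype.piFinset (fun _ : Fin n => Finset.range 2),
      (∏ k, (-1 : ℝ) ^ x k) * eval (toR x) P = 0 := by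
  simp_rw [eval_eq', Finset.mul_sum]
  rw [Finset.sum_comm]
  refine Finset.sum_eq_zero fun α hα => ?_
  obtain ⟨k, hk⟩ : ∃ k, α k = 0 := by
    by_contra! h
    have h1 : (α.sum fun _ e => e) < n := (le_totalDegree hα).trans_lt hP
    rw [Finsupp.sum_fintype _ _ (fun _ => rfl)] at h1
    have h2 : ∑ _k : Fin n, 1 ≤ ∑ k, α k :=
      Finset.sum_le_sum fun k _ => Nat.one_le_iff_ne_zero.2 (h k)
    simp at h2
    omega
  calc _ = coeff α P * ∑ x ∈ Fintype.piFinset (fun _ : Fin n => Finset.range 2),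
        ∏ k, ((-1 : ℝ) ^ x k * (x k : ℝ) ^ α k) := by
        rw [Finset.mul_sum]
        refine Finset.sum_congr rfl fun x _ => ?_
        rw [Finset.prod_mul_distrib]
        simp only [toR]
        ring
    _ = coeff α P * ∏ k, ∑ b ∈ Finset.range 2, ((-1 : ℝ) ^ b * (b : ℝ) ^ α k) := by
        rw [Finset.prod_univ_sum]
    _ = 0 := by
        rw [Finset.prod_eq_zero (Finset.mem_univ k) (by simp [hk, Finset.sum_range_succ]), mul_zero]

/-- A polynomial that is nonzero at exactly one point of the Boolean cube has degree at least `n`. -/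
lemma le_totalDegree_of_eval_ne_zero_iff {n : ℕ} (P : MvPolynomial (Fin n) ℝ) {a : Fin n → ℕ}
    (ha : ∀ k, a k < 2) (hPa : eval (toR a) P ≠ 0)
    (hP : ∀ x : Fin n → ℕ, (∀ k, x k < 2) → eval (toR x) P ≠ 0 → x = a) :
    n ≤ P.totalDegree := by
  by_contra! h
  have hsum := alternating_sum_eq_zero P h
  rw [Finset.sum_eq_single a] at hsum
  · refine mul_ne_zero (Finset.prod_ne_zero_iff.2 fun k _ => ?_) hPa hsum
    exact pow_ne_zero _ (by norm_num)
  · intro x hx hxa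
    by_contra hne
    exact hxa (hP x (by simpa using hx) (right_ne_zero_of_mul hne))
  · intro h'
    exact absurd (by simpa using ha) h'

/-- If `F` isolates `a` within its layer, then a polynomial vanishing on `E̲` but not at `a` has
degree at least `|E| - deg F`. -/
lemma card_le_totalDegree_add {n : ℕ} {E : Finset ℕ} (hE : E ⊆ Finset.range (n + 1))
    {P F : MvPolynomial (Fin n) ℝ} (hP : wdSet n (fun _ => 2) E ⊆ ZG n (fun _ => 2) P)
    {a : Fin n → ℕ} (ha : ∀ k, a k < 2) (haE : wt a ∉ E) (hPa : eval (toR a) P ≠ 0)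
    (hFa : eval (toR a) F ≠ 0)
    (hF : ∀ x : Fin n → ℕ, (∀ k, x k < 2) → wt x = wt a → eval (toR x) F ≠ 0 → x = a) :
    E.card ≤ P.totalDegree + F.totalDegree := by
  set W := (Finset.range (n + 1) \ E).erase (wt a) with hW
  have hWcard : W.card = n - E.card := by
    rw [hW, Finset.card_erase_of_mem, Finset.card_sdiff_of_subset hE, Finset.card_range]
    · omega
    · simpa [haE] using Nat.lt_succ_of_le (wt_le_of_mem ha)
  have hdeg : n ≤ (P * F * ∏ w ∈ W, wtForm n w).totalDegree := by
    refine le_totalDegree_of_eval_ne_zero_iff _ ha ?_ ?_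
    · rw [map_mul, map_mul]
      refine mul_ne_zero (mul_ne_zero hPa hFa) ?_
      rw [eval_prod_wtForm_ne_zero_iff]
      simp [hW]
    · intro x hx hne
      rw [map_mul, map_mul] at hne
      have hW' := right_ne_zero_of_mul hne
      have hP' := left_ne_zero_of_mul (left_ne_zero_of_mul hne)
      have hF' := right_ne_zero_of_mul (left_ne_zero_of_mul hne)
      rw [eval_prod_wtForm_ne_zero_iff] at hW'
      refine hF x hx ?_ hF'
      have hxE : wt x ∉ E := fun h => hP' (hP ⟨hx, h⟩).2
      by_contra h
      refine hW' ?_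
      simp only [hW, Finset.mem_erase, Finset.mem_sdiff, Finset.mem_range]
      exact ⟨h, Nat.lt_succ_of_le (wt_le_of_mem hx), hxE⟩
  have h1 := (totalDegree_mul (P * F) (∏ w ∈ W, wtForm n w))
  have h2 := totalDegree_mul P F
  have h3 := totalDegree_prod_le_card W (wtForm n) fun w _ => totalDegree_wtForm_le n w
  have h4 : E.card < n + 1 := by
    rw [← Finset.card_range (n + 1)]
    refine Finset.card_lt_card (hE.ssubset_of_ne ?_)
    rintro rfl
    exact haE (by simpa using Nat.lt_succ_of_le (wt_le_of_mem ha))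
  omega

lemma eq_of_le_of_wt_eq {n : ℕ} {x y : Fin n → ℕ} (h : ∀ k, x k ≤ y k) (hw : wt x = wt y) :
    x = y :=
  funext fun k => (Finset.sum_eq_sum_iff_of_le fun k _ => h k).1 hw k (Finset.mem_univ k)

/-- A polynomial vanishing on `E̲` but not at `a` has degree at least `|E| - wt(a)`. -/
lemma card_le_totalDegree_add_wt {n : ℕ} {E : Finset ℕ} (hE : E ⊆ Finset.range (n + 1))
    {P : MvPolynomial (Fin n) ℝ} (hP : wdSet n (fun _ => 2) E ⊆ ZG n (fun _ => 2) P)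
    {a : Fin n → ℕ} (ha : ∀ k, a k < 2) (haE : wt a ∉ E) (hPa : eval (toR a) P ≠ 0) :
    E.card ≤ P.totalDegree + wt a := by
  have key := card_le_totalDegree_add hE hP (F := ∏ k with a k = 1, X k) ha haE hPa ?_ ?_
  · have := totalDegree_prod_le_card (Finset.univ.filter fun k => a k = 1)
      (fun k => (X k : MvPolynomial (Fin n) ℝ)) fun k _ => (totalDegree_X k).le
    rw [card_ones ha] at this
    omega
  · rw [map_prod, Finset.prod_ne_zero_iff]
    intro k hk
    simp [toR, (Finset.mem_filter.1 hk).2]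
  · intro x hx hw hne
    rw [map_prod, Finset.prod_ne_zero_iff] at hne
    refine (eq_of_le_of_wt_eq (fun k => ?_) hw.symm).symm
    have h1 := ha k
    by_cases hk : a k = 1
    · have : x k ≠ 0 := by simpa [toR] using hne k (by simpa using hk)
      omega
    · omega

/-- A polynomial vanishing on `E̲` but not at `a` has degree at least `|E| - (n - wt(a))`. -/
lemma card_le_totalDegree_add_sub_wt {n : ℕ} {E : Finset ℕ} (hE : E ⊆ Finset.range (n + 1))
    {P : MvPolynomial (Fin n) ℝ} (hP : wdSet n (fun _ => 2) E ⊆ ZG n (fun _ => 2) P)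
    {a : Fin n → ℕ} (ha : ∀ k, a k < 2) (haE : wt a ∉ E) (hPa : eval (toR a) P ≠ 0) :
    E.card ≤ P.totalDegree + (n - wt a) := by
  have key := card_le_totalDegree_add hE hP (F := ∏ k with a k = 0, (X k - C 1)) ha haE hPa ?_ ?_
  · have := totalDegree_prod_le_card (Finset.univ.filter fun k => a k = 0)
      (fun k => (X k - C 1 : MvPolynomial (Fin n) ℝ))
      fun k _ => totalDegree_sub_C_le (totalDegree_X k).le 1
    rw [card_zeros ha] at this
    omega
  · rw [map_prod, Finset.prod_ne_zero_iff]
    intro k hk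
    simp [toR, (Finset.mem_filter.1 hk).2]
  · intro x hx hw hne
    rw [map_prod, Finset.prod_ne_zero_iff] at hne
    refine eq_of_le_of_wt_eq (fun k => ?_) hw
    have h1 := ha k
    have h2 := hx k
    by_cases hk : a k = 0
    · have : x k ≠ 1 := by
        simpa [toR, sub_eq_zero] using hne k (by simpa using hk)
      omega
    · omega

/-- A point of the cube that separates `i` disjoint pairs of coordinates has weight between
`i` and `n - i`. -/
lemma wt_mem_of_separates {n i : ℕ} {p : Fin i ⊕ Fin i → Fin n} (hp : Function.Injective p)
    {x : Fin n → ℕ} (hx : ∀ k, x k < 2) (hsep : ∀ t, x (p (Sum.inl t)) ≠ x (p (Sum.inr t))) :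
    i ≤ wt x ∧ wt x + i ≤ n := by
  have hpair : ∀ t, x (p (Sum.inl t)) + x (p (Sum.inr t)) = 1 := fun t => by
    have h1 := hx (p (Sum.inl t))
    have h2 := hx (p (Sum.inr t))
    have h3 := hsep t
    omega
  have hle : ∀ y : Fin n → ℕ, ∑ t, (y (p (Sum.inl t)) + y (p (Sum.inr t))) ≤ ∑ k, y k := by
    intro y
    rw [Finset.sum_add_distrib, ← Fintype.sum_sum_type (fun s => y (p s))]
    exact (Finset.sum_map Finset.univ ⟨p, hp⟩ y).symm.trans_le
      (Finset.sum_le_sum_of_subset (Finset.subset_univ _))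
  have h1 := hle x
  have h2 := hle fun k => 1 - x k
  have hpair' : ∀ t, (1 - x (p (Sum.inl t))) + (1 - x (p (Sum.inr t))) = 1 := fun t => by
    have := hpair t
    omega
  have htot : ∑ k, x k + ∑ k, (1 - x k) = n := by
    rw [← Finset.sum_add_distrib, Finset.sum_congr rfl (g := fun _ => 1)]
    · simp
    · intro k _
      have := hx k
      omega
  simp only [hpair, hpair', Finset.sum_const, Finset.card_univ, Fintype.card_fin, smul_eq_mul,
    mul_one] at h1 h2
  unfold wt
  omega

lemma mem_T {n i j : ℕ} : j ∈ T n i ↔ j < i ∨ (n - i + 1 ≤ j ∧ j ≤ n) := by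
  simp [T]

lemma card_T {n i : ℕ} (h : 2 * i ≤ n) : (T n i).card = 2 * i := by
  rw [T, Finset.card_union_of_disjoint]
  · simp
    omega
  · rw [Finset.disjoint_left]
    intro j hj hj'
    simp at hj hj'
    omega

/-- A point of weight between `i` and `n - i` is a nonzero of some degree-`i` polynomial that
vanishes on all layers of weight outside this range. -/
lemma exists_totalDegree_le_eval_ne_zero {n i : ℕ} {x : Fin n → ℕ} (hx : ∀ k, x k < 2)
    (h1 : i ≤ wt x) (h2 : wt x + i ≤ n) :
    ∃ P : MvPolynomial (Fin n) ℝ, P.totalDegree ≤ i ∧ eval (toR x) P ≠ 0 ∧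
      ∀ y : Fin n → ℕ, (∀ k, y k < 2) → ¬ (i ≤ wt y ∧ wt y + i ≤ n) → eval (toR y) P = 0 := by
  obtain ⟨A, hA, hAc⟩ := Finset.exists_subset_card_eq (h1.trans (card_ones hx).ge)
  obtain ⟨B, hB, hBc⟩ := Finset.exists_subset_card_eq
    ((show i ≤ n - wt x by omega).trans (card_zeros hx).ge)
  set f := A.orderEmbOfFin hAc
  set g := B.orderEmbOfFin hBc
  have hf : ∀ t, x (f t) = 1 := fun t => by simpa using hA (A.orderEmbOfFin_mem hAc t)
  have hg : ∀ t, x (g t) = 0 := fun t => by simpa using hB (B.orderEmbOfFin_mem hBc t)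
  have hinj : Function.Injective (Sum.elim f g) := by
    refine f.injective.sumElim g.injective fun s t h => ?_
    have := hf s
    rw [h, hg t] at this
    exact zero_ne_one this
  refine ⟨∏ t, (X (f t) - X (g t)), ?_, ?_, ?_⟩
  · have := totalDegree_prod_le_card Finset.univ
      (fun t => (X (f t) - X (g t) : MvPolynomial (Fin n) ℝ)) fun t _ =>
        (totalDegree_sub _ _).trans (max_le (totalDegree_X _).le (totalDegree_X _).le)
    simpa using this
  · rw [map_prod, Finset.prod_ne_zero_iff]
    intro t _
    simp [toR, hf, hg]
  · intro y hy hne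
    by_contra h
    rw [map_prod, ← ne_eq, Finset.prod_ne_zero_iff] at h
    refine hne (wt_mem_of_separates hinj hy fun t => ?_)
    simpa [toR, sub_eq_zero] using h t (Finset.mem_univ t)

/-- Some degree-`i` polynomial vanishes at exactly those points of the cube whose weight is less
than `i` or more than `n - i`. -/
lemma exists_totalDegree_le_eval_ne_zero_iff (n i : ℕ) :
    ∃ P : MvPolynomial (Fin n) ℝ, P.totalDegree ≤ i ∧
      ∀ y : Fin n → ℕ, (∀ k, y k < 2) → (eval (toR y) P ≠ 0 ↔ i ≤ wt y ∧ wt y + i ≤ n) := by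
  let cube := Fintype.piFinset (fun _ : Fin n => Finset.range 2)
  let ev (x : Fin n → ℕ) : Module.Dual ℝ (MvPolynomial (Fin n) ℝ) :=
    (aeval (toR x) : MvPolynomial (Fin n) ℝ →ₐ[ℝ] ℝ).toLinearMap
  have hev : ∀ x P, ev x P = eval (toR x) P := fun x P => by simp [ev, aeval_eq_eval]
  let V : Submodule ℝ (MvPolynomial (Fin n) ℝ) := restrictTotalDegree (Fin n) ℝ i ⊓
    ⨅ y : {y ∈ cube | ¬ (i ≤ wt y ∧ wt y + i ≤ n)}, LinearMap.ker (ev y)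
  have hV : ∀ P, P ∈ V ↔ P.totalDegree ≤ i ∧ ∀ y : Fin n → ℕ, (∀ k, y k < 2) →
      ¬ (i ≤ wt y ∧ wt y + i ≤ n) → eval (toR y) P = 0 := by
    intro P
    simp only [V, Submodule.mem_inf, mem_restrictTotalDegree, Submodule.mem_iInf,
      LinearMap.mem_ker, hev, Subtype.forall, Finset.mem_filter, cube, Fintype.mem_piFinset,
      Finset.mem_range, and_imp]
  obtain ⟨P, hPV, hP⟩ := Module.Dual.exists_forall_mem_ne_zero_of_forall_exists V
    (fun x : {x ∈ cube | i ≤ wt x ∧ wt x + i ≤ n} => ev x) (by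
      rintro ⟨x, hx⟩
      simp only [Finset.mem_filter, cube, Fintype.mem_piFinset, Finset.mem_range] at hx
      obtain ⟨P, hd, hne, h0⟩ := exists_totalDegree_le_eval_ne_zero hx.1 hx.2.1 hx.2.2
      exact ⟨P, (hV P).2 ⟨hd, h0⟩, by simpa [hev] using hne⟩)
  obtain ⟨hd, h0⟩ := (hV P).1 hPV
  refine ⟨P, hd, fun y hy => ⟨fun h => ?_, fun h => ?_⟩⟩
  · by_contra hne
    exact h (h0 y hy hne)
  · rw [← hev]
    exact hP ⟨y, by simpa [cube, hy] using h⟩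

/-- `E̲` has an exact polynomial cover of degree `|E| - i` whenever `T_{n,i} ⊆ E`. -/
lemma exists_exact_cover {n i : ℕ} {E : Finset ℕ} (hi : 2 * i ≤ n) (hT : T n i ⊆ E) :
    ∃ P : MvPolynomial (Fin n) ℝ, P.totalDegree ≤ E.card - i ∧
      ZG n (fun _ => 2) P = wdSet n (fun _ => 2) E := by
  obtain ⟨Q, hQd, hQ⟩ := exists_totalDegree_le_eval_ne_zero_iff n i
  refine ⟨Q * ∏ w ∈ E \ T n i, wtForm n w, ?_, ?_⟩
  · have h1 := totalDegree_mul Q (∏ w ∈ E \ T n i, wtForm n w)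
    have h2 := totalDegree_prod_le_card (E \ T n i) (wtForm n) fun w _ => totalDegree_wtForm_le n w
    have h3 := Finset.card_le_card hT
    rw [Finset.card_sdiff_of_subset hT] at h2
    rw [card_T hi] at h2 h3
    omega
  · ext x
    simp only [ZG, wdSet, Set.mem_ofPred_eq, gridSet]
    refine and_congr_right fun hx => not_iff_not.1 ?_
    rw [← ne_eq, map_mul, mul_ne_zero_iff, eval_prod_wtForm_ne_zero_iff, hQ x hx]
    have hxn := wt_le_of_mem hx
    have hmem : wt x ∉ T n i ↔ i ≤ wt x ∧ wt x + i ≤ n := by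
      rw [mem_T]
      omega
    rw [← hmem, Finset.mem_sdiff]
    have := @hT (wt x)
    tauto

/-- A proper hyperplane cover of `E̲` indexed by a finite type can be reindexed by `Fin m`. -/
lemma card_mem_of_hyperplane_cover {n : ℕ} {E : Finset ℕ} {ι : Type*} [Fintype ι]
    (w : ι → Fin n → ℝ) (c : ι → ℝ)
    (hw : ∀ t, w t ≠ 0) (hcov : ∀ x ∈ wdSet n (fun _ => 2) E, ∃ t, onHyp (w t) (c t) x)
    (hprop : ∀ j ≤ n, j ∉ E → ∃ x ∈ layer n (fun _ => 2) j, ∀ t, ¬ onHyp (w t) (c t) x) :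
    Fintype.card ι ∈ {m | ∃ (w : Fin m → Fin n → ℝ) (c : Fin m → ℝ), (∀ t, w t ≠ 0) ∧
      (∀ x ∈ wdSet n (fun _ => 2) E, ∃ t, onHyp (w t) (c t) x) ∧
      ∀ j ≤ Ntot n (fun _ => 2), j ∉ E →
        ¬ (layer n (fun _ => 2) j ⊆ {x | ∃ t, onHyp (w t) (c t) x})} := by
  let e := (Fintype.equivFin ι).symm
  refine ⟨w ∘ e, c ∘ e, fun t => hw _, fun x hx => ?_, fun j hj hjE hsub => ?_⟩
  · obtain ⟨t, ht⟩ := hcov x hx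
    exact ⟨e.symm t, by simpa using ht⟩
  · rw [Ntot_two] at hj
    obtain ⟨x, hx, hne⟩ := hprop j hj hjE
    obtain ⟨t, ht⟩ := hsub hx
    exact hne _ ht

/-- `E̲` has a proper hyperplane cover of size `|E| - i` whenever `T_{n,i} ⊆ E`. -/
lemma exists_hyperplane_cover {n i : ℕ} (hn : 1 ≤ n) {E : Finset ℕ} (hi : 2 * i ≤ n)
    (hT : T n i ⊆ E) :
    E.card - i ∈ {m | ∃ (w : Fin m → Fin n → ℝ) (c : Fin m → ℝ), (∀ t, w t ≠ 0) ∧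
      (∀ x ∈ wdSet n (fun _ => 2) E, ∃ t, onHyp (w t) (c t) x) ∧
      ∀ j ≤ Ntot n (fun _ => 2), j ∉ E →
        ¬ (layer n (fun _ => 2) j ⊆ {x | ∃ t, onHyp (w t) (c t) x})} := by
  have hcard : Fintype.card (Fin i ⊕ {j // j ∈ E \ T n i}) = E.card - i := by
    have h3 := Finset.card_le_card hT
    rw [Fintype.card_sum, Fintype.card_fin, Fintype.card_coe, Finset.card_sdiff_of_subset hT]
    rw [card_T hi] at h3 ⊢
    omega
  let f (t : Fin i) : Fin n := ⟨t, by omega⟩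
  let g (t : Fin i) : Fin n := ⟨n - 1 - t, by omega⟩
  have hinj : Function.Injective (Sum.elim f g) := by
    refine Function.Injective.sumElim ?_ ?_ ?_
    · intro s t h
      simp only [f, Fin.mk.injEq] at h
      omega
    · intro s t h
      simp only [g, Fin.mk.injEq] at h
      omega
    · intro s t h
      simp only [f, g, Fin.mk.injEq] at h
      omega
  have hpair : ∀ t (x : Fin n → ℕ), onHyp (Pi.single (f t) 1 - Pi.single (g t) 1) 0 x ↔
      x (f t) = x (g t) := by
    intro t x
    simp [onHyp, sub_mul, Finset.sum_sub_distrib, Pi.single_apply, sub_eq_zero]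
  have hwt : ∀ (j : ℕ) (x : Fin n → ℕ), onHyp (fun _ => 1) j x ↔ wt x = j := by
    intro j x
    simp only [onHyp, one_mul, wt]
    exact_mod_cast Iff.rfl
  rw [← hcard]
  refine card_mem_of_hyperplane_cover
    (Sum.elim (fun t => Pi.single (f t) 1 - Pi.single (g t) 1) fun _ _ => 1)
    (Sum.elim (fun _ => 0) fun j => (j : ℕ)) ?_ ?_ ?_
  · rintro (t | j) h
    · have hne : f t ≠ g t := fun h' => by simpa using @hinj (Sum.inl t) (Sum.inr t) h'
      simpa [hne] using congrFun h (f t)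
    · simpa using congrFun h ⟨0, hn⟩
  · rintro x ⟨hx, hxE⟩
    by_cases hxT : wt x ∈ T n i
    · by_contra! hno
      have := wt_mem_of_separates hinj hx fun t => (hpair t x).not.1 (hno (Sum.inl t))
      rw [mem_T] at hxT
      omega
    · exact ⟨Sum.inr ⟨wt x, Finset.mem_sdiff.2 ⟨hxE, hxT⟩⟩, (hwt _ x).2 rfl⟩
  · intro j hj hjE
    have hjT : j ∉ T n i := fun h => hjE (hT h)
    rw [mem_T] at hjT
    refine ⟨initialPoint n j, ⟨initialPoint_lt n j, wt_initialPoint hj⟩, ?_⟩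
    rintro (t | m) h
    · have h' := (hpair t _).1 h
      have h1 : (t : ℕ) < j := by omega
      have h2 : ¬ (n - 1 - (t : ℕ) < j) := by omega
      simp [initialPoint, f, g, h1, h2] at h'
    · have h' := (hwt _ _).1 h
      rw [wt_initialPoint hj] at h'
      exact hjE (h' ▸ (Finset.mem_sdiff.1 m.2).1)

/-- The product of the equations of a proper hyperplane cover is a proper polynomial cover. -/
lemma PPC_le_of_hyperplane_cover {n m : ℕ} {E : Finset ℕ} (w : Fin m → Fin n → ℝ) (c : Fin m → ℝ)
    (hcov : ∀ x ∈ wdSet n (fun _ => 2) E, ∃ t, onHyp (w t) (c t) x)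
    (hprop : ∀ j ≤ Ntot n (fun _ => 2), j ∉ E →
      ¬ (layer n (fun _ => 2) j ⊆ {x | ∃ t, onHyp (w t) (c t) x})) :
    PPC n (fun _ => 2) E ≤ m := by
  let P : MvPolynomial (Fin n) ℝ := ∏ t, (∑ k, C (w t k) * X k - C (c t))
  have hev : ∀ x : Fin n → ℕ, eval (toR x) P = 0 ↔ ∃ t, onHyp (w t) (c t) x := by
    intro x
    simp [P, map_prod, Finset.prod_eq_zero_iff, sub_eq_zero, onHyp, toR]
  have hdeg : P.totalDegree ≤ m := by
    have := totalDegree_prod_le_card Finset.univ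
      (fun t => (∑ k, C (w t k) * X k - C (c t) : MvPolynomial (Fin n) ℝ)) fun t _ =>
        totalDegree_sub_C_le (totalDegree_finsetSum_le fun k _ =>
          (totalDegree_mul _ _).trans (by simp)) _
    simpa using this
  refine le_trans (Nat.sInf_le ⟨P, rfl, fun x hx => ⟨hx.1, (hev x).2 (hcov x hx)⟩, ?_⟩) hdeg
  exact fun j hj hjE hsub => hprop j hj hjE fun x hx => (hev x).1 (hsub hx).2

/-- An exact polynomial cover is proper. -/
lemma layer_not_subset_of_exact {n : ℕ} {E : Finset ℕ} {P : MvPolynomial (Fin n) ℝ}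
    (hP : ZG n (fun _ => 2) P = wdSet n (fun _ => 2) E) {j : ℕ} (hj : j ≤ n) (hjE : j ∉ E) :
    ¬ (layer n (fun _ => 2) j ⊆ ZG n (fun _ => 2) P) := by
  intro hsub
  have hw := wt_initialPoint hj
  have h := hsub ⟨initialPoint_lt n j, hw⟩
  rw [hP] at h
  exact hjE (hw ▸ h.2)

lemma T_succ_subset {n i : ℕ} {E : Finset ℕ} (hi : i + 1 ≤ n) (hT : T n i ⊆ E) (h1 : i ∈ E)
    (h2 : n - i ∈ E) : T n (i + 1) ⊆ E := by
  intro j hj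
  rw [mem_T] at hj
  by_cases hji : j = i
  · exact hji ▸ h1
  by_cases hjn : j = n - i
  · exact hjn ▸ h2
  exact hT (mem_T.2 (by omega))


/-- in the Boolean cube,
`EPC_n(E) = PPC_n(E) = PHC_n(E) = |E| - max{i ∈ [0,n] : T_{n,i} ⊆ E}`. -/
theorem stmt19 (n : ℕ) (hn : 1 ≤ n) (E : Finset ℕ) (hE : E ⊂ Finset.range (n + 1)) :
    EPC n (fun _ => 2) E = PPC n (fun _ => 2) E ∧
    PPC n (fun _ => 2) E = PHC n (fun _ => 2) E ∧
    PHC n (fun _ => 2) E = E.card - sSup {i | i ≤ n ∧ T n i ⊆ E} := by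
  set S := {i | i ≤ n ∧ T n i ⊆ E} with hS
  set i := sSup S with hi_def
  have hbdd : BddAbove S := ⟨n, fun _ h => h.1⟩
  obtain ⟨hin, hT⟩ : i ∈ S := Nat.sSup_mem ⟨0, Nat.zero_le n, by simp [T]⟩ hbdd
  have hi : 2 * i ≤ n := by
    by_contra! h
    refine hE.2 fun j hj => hT (mem_T.2 ?_)
    rw [Finset.mem_range] at hj
    omega
  obtain ⟨j, hj, hjE⟩ : ∃ j, (j = i ∨ j = n - i) ∧ j ∉ E := by
    by_contra! h
    have hmem : i + 1 ∈ S := ⟨by omega,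
      T_succ_subset (by omega) hT (h i (Or.inl rfl)) (h (n - i) (Or.inr rfl))⟩
    have := le_csSup hbdd hmem
    omega
  obtain ⟨P₀, hP₀d, hP₀⟩ := exists_exact_cover hi hT
  have hPPC_EPC : PPC n (fun _ => 2) E ≤ EPC n (fun _ => 2) E := by
    obtain ⟨P, hPd, hP⟩ := Nat.sInf_mem (s := {d | ∃ P : MvPolynomial (Fin n) ℝ,
      P.totalDegree = d ∧ ZG n (fun _ => 2) P = wdSet n (fun _ => 2) E}) ⟨_, P₀, rfl, hP₀⟩
    refine Nat.sInf_le ⟨P, hPd, hP.ge, fun j hj hjE => ?_⟩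
    exact layer_not_subset_of_exact hP (Ntot_two n ▸ hj) hjE
  have hEPC : EPC n (fun _ => 2) E ≤ E.card - i :=
    le_trans (Nat.sInf_le ⟨P₀, rfl, hP₀⟩) hP₀d
  have hmem := exists_hyperplane_cover hn hi hT
  have hPHC : PHC n (fun _ => 2) E ≤ E.card - i := Nat.sInf_le hmem
  have hPPC_PHC : PPC n (fun _ => 2) E ≤ PHC n (fun _ => 2) E := by
    obtain ⟨w, c, -, hcov, hprop⟩ := Nat.sInf_mem ⟨_, hmem⟩
    exact PPC_le_of_hyperplane_cover w c hcov hprop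
  have hPPC : E.card - i ≤ PPC n (fun _ => 2) E := by
    refine le_csInf ⟨_, P₀, rfl, hP₀.ge, fun j hj hjE =>
      layer_not_subset_of_exact hP₀ (Ntot_two n ▸ hj) hjE⟩ ?_
    rintro d ⟨P, rfl, hcov, hprop⟩
    obtain ⟨a, ⟨ha, haw⟩, haP⟩ := Set.not_subset.1
      (hprop j (by rw [Ntot_two]; omega) hjE)
    have hPa : eval (toR a) P ≠ 0 := fun h => haP ⟨ha, h⟩
    have haE : wt a ∉ E := haw ▸ hjE
    have h1 := card_le_totalDegree_add_wt hE.1 hcov ha haE hPa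
    have h2 := card_le_totalDegree_add_sub_wt hE.1 hcov ha haE hPa
    omega
  omega

end CoveringSymmetric
end
end
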